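/- Let D, P ∈ ℕ and consider matrices A ∈ ℝ^{D×P} with columns a_1, …, a_P. The function A ↦ Σ_{p=1}^P ‖a_p‖∞ is the convex envelope of the number of nonzero columns on the box {A : ‖a_p‖∞ ≤ 1 for all p}: (i) it is convex, and for every A in the box, Σ_{p=1}^P ‖a_p‖∞ ≤ #{p : a_p ≠ 0}; and (ii) every convex function h on ℝ^{D×P} satisfying h(A) ≤ #{p : a_p ≠ 0} for all A in the box satisfies h(A) ≤ Σ_{p=1}^P ‖a_p‖∞ for all A in the box. -/

import Mathlib

theorem Real.iSup_abs_eq_norm {ι : Type*} [Fintype ι] (v : ι → ℝ) : ⨆ i, |v i| = ‖v‖ := by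
  refine le_antisymm (Real.iSup_le (fun i => norm_le_pi_norm v i) (norm_nonneg v)) ?_
  exact (pi_norm_le_iff_of_nonneg (Real.iSup_nonneg fun i => abs_nonneg (v i))).2
    fun i => le_ciSup (f := fun j => |v j|) (Set.finite_range _).bddAbove i

/-- A convex function bounded on a product of unit balls by the number of nonzero coordinates
is bounded there by any mixed count in which the coordinates in `s` are weighted by their norm. -/
theorem ConvexOn.le_sum_ite_norm {ι E : Type*} [Fintype ι] [DecidableEq ι]
    [NormedAddCommGroup E] [NormedSpace ℝ E] [DecidableEq E] {h : (ι → E) → ℝ}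
    (hconv : ConvexOn ℝ Set.univ h)
    (hle : ∀ a : ι → E, (∀ i, ‖a i‖ ≤ 1) → h a ≤ ∑ i, if a i = 0 then (0 : ℝ) else 1)
    (s : Finset ι) (a : ι → E) (ha : ∀ i, ‖a i‖ ≤ 1) :
    h a ≤ ∑ i, if i ∈ s then ‖a i‖ else if a i = 0 then 0 else 1 := by
  induction s using Finset.induction_on generalizing a with
  | empty => simpa using hle a ha
  | insert q s hq ih =>
    set R : ℝ := ∑ i ∈ Finset.univ.erase q,
      if i ∈ s then ‖a i‖ else if a i = 0 then 0 else 1 with hR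
    have bound : ∀ u : E, ‖u‖ ≤ 1 →
        h (Function.update a q u) ≤ (if u = 0 then 0 else 1) + R := by
      intro u hu
      refine (ih (Function.update a q u) fun i => ?_).trans_eq ?_
      · obtain rfl | hi := eq_or_ne i q
        · simpa using hu
        · simpa [hi] using ha i
      · rw [← Finset.add_sum_erase _ _ (Finset.mem_univ q), hR]
        congr 1
        · simp [hq]
        · refine Finset.sum_congr rfl fun i hi => ?_
          rw [Function.update_of_ne (Finset.ne_of_mem_erase hi)]
    have hu : ‖‖a q‖⁻¹ • a q‖ ≤ 1 := by
      rw [norm_smul, norm_inv, norm_norm]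
      exact inv_mul_le_one
    have hB : h (Function.update a q (‖a q‖⁻¹ • a q)) ≤ 1 + R := by
      refine (bound _ hu).trans ?_
      split_ifs <;> linarith
    have hC : h (Function.update a q 0) ≤ R := by simpa using bound 0 (by simp)
    have hdecomp : ‖a q‖ • Function.update a q (‖a q‖⁻¹ • a q)
        + (1 - ‖a q‖) • Function.update a q 0 = a := by
      ext1 i
      obtain rfl | hi := eq_or_ne i q
      · obtain h0 | h0 := eq_or_ne (a i) 0
        · simp [h0]
        · simp [smul_smul, mul_inv_cancel₀ (norm_ne_zero_iff.2 h0)]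
      · simp [hi, ← add_smul]
    have hsum : (∑ i, if i ∈ insert q s then ‖a i‖ else if a i = 0 then (0 : ℝ) else 1)
        = ‖a q‖ + R := by
      rw [← Finset.add_sum_erase _ _ (Finset.mem_univ q), hR]
      congr 1
      · simp
      · refine Finset.sum_congr rfl fun i hi => ?_
        simp [Finset.mem_insert, Finset.ne_of_mem_erase hi]
    have key := hconv.2 (Set.mem_univ (Function.update a q (‖a q‖⁻¹ • a q)))
      (Set.mem_univ (Function.update a q 0)) (norm_nonneg (a q)) (sub_nonneg.2 (ha q))
      (add_sub_cancel _ _)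
    rw [hdecomp, smul_eq_mul, smul_eq_mul] at key
    rw [hsum]
    have h1 := mul_le_mul_of_nonneg_left hB (norm_nonneg (a q))
    have h2 := mul_le_mul_of_nonneg_left hC (sub_nonneg.2 (ha q))
    linarith

theorem Set.ncard_setOf_ne_zero_eq_sum {ι E : Type*} [Fintype ι] [Zero E] [DecidableEq E]
    (a : ι → E) : ({i | a i ≠ 0}.ncard : ℝ) = ∑ i, if a i = 0 then (0 : ℝ) else 1 := by
  rw [Set.ncard_eq_toFinset_card']
  simp [Finset.sum_ite]

/-- `A ↦ Σ_p ‖a_p‖∞` (sum of columnwise ℓ∞ norms) is the convex envelope of the number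
of nonzero columns on the box `{A : ‖a_p‖∞ ≤ 1 for all p}`: it is convex, it minorizes
the nonzero-column count on the box, and it dominates every convex minorant of that
count on the box. -/
theorem group_linf_convex_envelope_of_column_card (D P : ℕ) :
    ConvexOn ℝ Set.univ (fun A : Matrix (Fin D) (Fin P) ℝ => ∑ p, ⨆ d, |A d p|) ∧
    (∀ A : Matrix (Fin D) (Fin P) ℝ, (∀ p, (⨆ d, |A d p|) ≤ 1) →
      (∑ p, ⨆ d, |A d p|) ≤ ({p : Fin P | (fun d => A d p) ≠ 0}.ncard : ℝ)) ∧
    (∀ h : Matrix (Fin D) (Fin P) ℝ → ℝ, ConvexOn ℝ Set.univ h →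
      (∀ A : Matrix (Fin D) (Fin P) ℝ, (∀ p, (⨆ d, |A d p|) ≤ 1) →
        h A ≤ ({p : Fin P | (fun d => A d p) ≠ 0}.ncard : ℝ)) →
      ∀ A : Matrix (Fin D) (Fin P) ℝ, (∀ p, (⨆ d, |A d p|) ≤ 1) →
        h A ≤ ∑ p, ⨆ d, |A d p|) := by
  classical
  have hnorm (A : Matrix (Fin D) (Fin P) ℝ) (p : Fin P) : ⨆ d, |A d p| = ‖A.transpose p‖ :=
    Real.iSup_abs_eq_norm (A.transpose p)
  have hcard (A : Matrix (Fin D) (Fin P) ℝ) :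
      ({p : Fin P | (fun d => A d p) ≠ 0}.ncard : ℝ)
        = ∑ p, if A.transpose p = 0 then (0 : ℝ) else 1 :=
    Set.ncard_setOf_ne_zero_eq_sum A.transpose
  simp only [hnorm, hcard]
  refine ⟨⟨convex_univ, fun A _ B _ s t hs ht _ => ?_⟩, fun A hA => ?_, fun h hconv hle A hA => ?_⟩
  · simp only [smul_eq_mul, Finset.mul_sum, ← Finset.sum_add_distrib]
    refine Finset.sum_le_sum fun p _ => ?_
    have hp : (s • A + t • B).transpose p = s • A.transpose p + t • B.transpose p := rfl
    rw [hp]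
    refine (norm_add_le _ _).trans_eq ?_
    rw [norm_smul_of_nonneg hs, norm_smul_of_nonneg ht]
  · refine Finset.sum_le_sum fun p _ => ?_
    split_ifs with h0
    · simp [h0]
    · exact hA p
  · have hconv' : ConvexOn ℝ Set.univ
        (fun a : Fin P → Fin D → ℝ => h (Matrix.of a).transpose) :=
      ⟨convex_univ, fun a _ b _ s t hs ht hst =>
        hconv.2 (Set.mem_univ (Matrix.of a).transpose) (Set.mem_univ (Matrix.of b).transpose)
          hs ht hst⟩
    have key := hconv'.le_sum_ite_norm (fun a ha => hle (Matrix.of a).transpose ha)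
      Finset.univ A.transpose hA
    simp only [Finset.mem_univ, if_true] at key
    exact key
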